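/- Let D_in be a fixed n×m binary dataset and let 𝒯 and 𝒰 be finite sets of tiles, each with nonempty area and each exact with respect to D_in, such that area(𝒰) ⊆ area(𝒯). Let p_𝒯 and p_𝒰 be the corresponding product distributions (entry marginal equal to D_in(i,j) on covered entries and 1/2 elsewhere). Then KL(p_𝒯 ‖ p_𝒰) = |area(𝒯) \ area(𝒰)| · log 2. -/

import Mathlib

open Finset

namespace TileCompare

variable {n m : ℕ}

/-- A binary dataset: an `n × m` matrix with entries in `{0,1}`, encoded as booleans. -/
abbrev Dataset (n m : ℕ) := Fin n → Fin m → Bool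

/-- A tile: a set of rows together with a set of columns. -/
abbrev Tile (n m : ℕ) := Finset (Fin n) × Finset (Fin m)

/-- The area of a tile: the Cartesian product of its rows and columns. -/
def area (T : Tile n m) : Finset (Fin n × Fin m) := T.1 ×ˢ T.2

/-- The frequency of a tile in a dataset: the proportion of ones inside its area. -/
noncomputable def freqD (T : Tile n m) (D : Dataset n m) : ℝ :=
  (∑ e ∈ area T, if D e.1 e.2 then (1 : ℝ) else 0) / ((area T).card : ℝ)

/-- The frequency of a tile under a distribution over datasets. -/
noncomputable def freqP (T : Tile n m) (p : Dataset n m → ℝ) : ℝ :=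
  ∑ D : Dataset n m, p D * freqD T D

/-- `p` is a probability distribution over the (finite) space of all `n × m` binary datasets. -/
def IsDistribution (p : Dataset n m → ℝ) : Prop :=
  (∀ D, 0 ≤ p D) ∧ ∑ D : Dataset n m, p D = 1

/-- The entry marginal `p((i,j) = v)`. -/
noncomputable def marginal (p : Dataset n m → ℝ) (e : Fin n × Fin m) (v : Bool) : ℝ :=
  ∑ D : Dataset n m, if D e.1 e.2 = v then p D else 0

/-- Shannon entropy (natural logarithm; `0 · log 0 = 0` since `Real.log 0 = 0`). -/
noncomputable def entropy (p : Dataset n m → ℝ) : ℝ :=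
  -∑ D : Dataset n m, p D * Real.log (p D)

/-- Kullback–Leibler divergence (natural logarithm, conventions `0·log 0 = 0`, `0·log(0/0) = 0`). -/
noncomputable def KL (p q : Dataset n m → ℝ) : ℝ :=
  ∑ D : Dataset n m, p D * Real.log (p D / q D)

/-- `p` is a distribution matching the target frequencies `α` on the tile set `Ts`,
i.e. `p ∈ P(Ts, α)`. -/
def Consistent (Ts : Finset (Tile n m)) (α : Tile n m → ℝ) (p : Dataset n m → ℝ) : Prop :=
  IsDistribution p ∧ ∀ T ∈ Ts, freqP T p = α T

/-- `p` is a maximum entropy distribution for `(Ts, α)`. -/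
def IsMaxEnt (Ts : Finset (Tile n m)) (α : Tile n m → ℝ) (p : Dataset n m → ℝ) : Prop :=
  Consistent Ts α p ∧ ∀ q, Consistent Ts α q → entropy q ≤ entropy p

/-- The area covered by a set of tiles. -/
def areaSet (Ts : Finset (Tile n m)) : Finset (Fin n × Fin m) := Ts.biUnion area

/-- Entry marginal of the product distribution associated with a set of tiles exact w.r.t.
`Din`: equal to the indicator of the data entry on covered entries, `1/2` elsewhere. -/
noncomputable def mu (Din : Dataset n m) (Ts : Finset (Tile n m))
    (e : Fin n × Fin m) (v : Bool) : ℝ :=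
  if e ∈ areaSet Ts then (if Din e.1 e.2 = v then 1 else 0) else 1 / 2

/-- The product distribution associated with a set of exact tiles. -/
noncomputable def prodDist (Din : Dataset n m) (Ts : Finset (Tile n m))
    (D : Dataset n m) : ℝ :=
  ∏ e : Fin n × Fin m, mu Din Ts e (D e.1 e.2)

/-- The distance `d(Ts, Us; Bs)` computed from the product distributions of exact tile sets. -/
noncomputable def distE (Din : Dataset n m) (Ts Us Bs : Finset (Tile n m)) : ℝ :=
  if KL (prodDist Din (Ts ∪ Us ∪ Bs)) (prodDist Din Bs) = 0 then 1
  else (KL (prodDist Din (Ts ∪ Us ∪ Bs)) (prodDist Din (Us ∪ Bs))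
      + KL (prodDist Din (Ts ∪ Us ∪ Bs)) (prodDist Din (Ts ∪ Bs)))
      / KL (prodDist Din (Ts ∪ Us ∪ Bs)) (prodDist Din Bs)

/-- The distance `d(Ts, Us; Bs)` computed from given (maximum entropy) distributions
`pM, pTB, pUB, pB` for `Ts ∪ Us ∪ Bs`, `Ts ∪ Bs`, `Us ∪ Bs`, `Bs` respectively. -/
noncomputable def distKL (pM pTB pUB pB : Dataset n m → ℝ) : ℝ :=
  if KL pM pB = 0 then 1 else (KL pM pUB + KL pM pTB) / KL pM pB

theorem mu_sum (Din : Dataset n m) (Ts : Finset (Tile n m)) (e : Fin n × Fin m) :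
    ∑ v : Bool, mu Din Ts e v = 1 := by
  unfold mu
  by_cases h : e ∈ areaSet Ts
  · simp [h]
  · simp [h]

theorem prodDist_sum (Din : Dataset n m) (Ts : Finset (Tile n m)) :
    ∑ D : Dataset n m, prodDist Din Ts D = 1 := by
  have h : ∑ D : Dataset n m, prodDist Din Ts D
      = ∑ f : Fin n × Fin m → Bool, ∏ e, mu Din Ts e (f e) := by
    refine (Fintype.sum_equiv (Equiv.curry (Fin n) (Fin m) Bool) _ _ ?_).symm
    intro f
    rfl
  rw [h, ← Fintype.prod_sum]
  exact Finset.prod_eq_one (fun e _ => mu_sum Din Ts e)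

theorem ratio_eq (Din : Dataset n m) (Ts Us : Finset (Tile n m))
    (hsub : areaSet Us ⊆ areaSet Ts) (D : Dataset n m) (hD : prodDist Din Ts D ≠ 0) :
    prodDist Din Ts D / prodDist Din Us D = 2 ^ (areaSet Ts \ areaSet Us).card := by
  unfold prodDist at *
  rw [← Finset.prod_div_distrib]
  have h : ∀ e : Fin n × Fin m, mu Din Ts e (D e.1 e.2) / mu Din Us e (D e.1 e.2)
      = if e ∈ areaSet Ts \ areaSet Us then (2 : ℝ) else 1 := by
    intro e
    have he := Finset.prod_ne_zero_iff.mp hD e (Finset.mem_univ e)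
    have hs := @hsub e
    unfold mu at *
    by_cases h1 : e ∈ areaSet Ts <;> by_cases h2 : e ∈ areaSet Us <;> simp_all
  rw [Finset.prod_congr rfl (fun e _ => h e), Finset.prod_ite_mem]
  simp

/-- For exact tile sets `Ts`, `Us` with `area(Us) ⊆ area(Ts)`, the KL
divergence between the product distributions is `|area(Ts) \ area(Us)| · log 2`. -/
theorem kl_exact_tiles {n m : ℕ} (Din : Dataset n m) (Ts Us : Finset (Tile n m))
    (hneT : ∀ T ∈ Ts, (area T).Nonempty)
    (hneU : ∀ T ∈ Us, (area T).Nonempty)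
    (hexT : ∀ T ∈ Ts, freqD T Din = 0 ∨ freqD T Din = 1)
    (hexU : ∀ T ∈ Us, freqD T Din = 0 ∨ freqD T Din = 1)
    (hsub : areaSet Us ⊆ areaSet Ts) :
    KL (prodDist Din Ts) (prodDist Din Us)
      = ((areaSet Ts \ areaSet Us).card : ℝ) * Real.log 2 := by
  unfold KL
  have h : ∀ D : Dataset n m,
      prodDist Din Ts D * Real.log (prodDist Din Ts D / prodDist Din Us D)
      = prodDist Din Ts D * (((areaSet Ts \ areaSet Us).card : ℝ) * Real.log 2) := by
    intro D
    by_cases hD : prodDist Din Ts D = 0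
    · simp [hD]
    · rw [ratio_eq Din Ts Us hsub D hD, Real.log_pow]
  rw [Finset.sum_congr rfl (fun D _ => h D), ← Finset.sum_mul, prodDist_sum, one_mul]
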